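/- arXiv:2003.00433 — 2 statements merged into one kernel-verified Lean document; each statement's English description precedes it below -/
import Mathlib

section
/- Let {H^j}_{j≥0} be n×n entrywise nonnegative column-stochastic matrices (1^T H^j = 1^T), let v^0 ∈ ℝ^n be entrywise nonnegative with 1^T v^0 = s > 0, and define v^{j+1} = H^j v^j and V^j = diag(v^j). Fix k ≥ 0, t ≥ 1, let Φ = H^{k+t−1} ⋯ H^k, and suppose: (i) there is a stochastic vector φ ∈ ℝ^n with ‖Φ − φ 1^T‖_F ≤ ε, and (ii) every nonzero entry of v^{k+t} is at least κ > 0. Let (V^{k+t})† be the diagonal matrix whose i-th diagonal entry is 1/v^{k+t}_i if v^{k+t}_i ≠ 0 and 0 otherwise, and let 1_V = V^{k+t}(V^{k+t})† 1 (the 0/1 indicator of the support of v^{k+t}). Then ‖(V^{k+t})† Φ V^k − (1/s) 1_V (v^k)^T‖_F ≤ (ε/κ) · (1 + √n ‖v^k‖₂ / s) · (max_i v^k_i). -/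
open Matrix

/-- The Frobenius norm of a real matrix. -/
noncomputable def frobNorm {m n : ℕ} (A : Matrix (Fin m) (Fin n) ℝ) : ℝ :=
  Real.sqrt (∑ i, ∑ j, (A i j) ^ 2)

/-- Ordered product `M^{k+t-1} ⋯ M^{k+1} M^k` (the identity for `t = 0`). -/
noncomputable def prodFrom {n : ℕ} (M : ℕ → Matrix (Fin n) (Fin n) ℝ) (k : ℕ) :
    ℕ → Matrix (Fin n) (Fin n) ℝ
  | 0 => 1
  | t + 1 => M (k + t) * prodFrom M k t

open scoped Matrix.Norms.Frobenius in
theorem frobNorm_eq_norm {m n : ℕ} (A : Matrix (Fin m) (Fin n) ℝ) : frobNorm A = ‖A‖ := by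
  rw [Matrix.frobenius_norm_def, frobNorm, Real.sqrt_eq_rpow]
  simp

open scoped Matrix.Norms.Frobenius in
theorem frobNorm_sub_le {m n : ℕ} (A B : Matrix (Fin m) (Fin n) ℝ) :
    frobNorm (A - B) ≤ frobNorm A + frobNorm B := by
  simpa only [frobNorm_eq_norm] using norm_sub_le A B

open scoped Matrix.Norms.Frobenius in
theorem frobNorm_mul_le {l m n : ℕ} (A : Matrix (Fin l) (Fin m) ℝ)
    (B : Matrix (Fin m) (Fin n) ℝ) : frobNorm (A * B) ≤ frobNorm A * frobNorm B := by
  simpa only [frobNorm_eq_norm] using Matrix.frobenius_norm_mul A B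

open scoped Matrix.Norms.Frobenius in
theorem frobNorm_smul {m n : ℕ} (c : ℝ) (A : Matrix (Fin m) (Fin n) ℝ) :
    frobNorm (c • A) = |c| * frobNorm A := by
  simpa only [frobNorm_eq_norm, Real.norm_eq_abs] using norm_smul c A

theorem frobNorm_mono {m n : ℕ} {A B : Matrix (Fin m) (Fin n) ℝ}
    (h : ∀ i j, |A i j| ≤ |B i j|) : frobNorm A ≤ frobNorm B :=
  Real.sqrt_le_sqrt <| Finset.sum_le_sum fun i _ => Finset.sum_le_sum fun j _ =>
    sq_le_sq.2 (h i j)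

theorem frobNorm_vecMulVec_one {m n : ℕ} (u : Fin m → ℝ) :
    frobNorm (Matrix.vecMulVec u (fun _ : Fin n => (1 : ℝ))) =
      Real.sqrt n * Real.sqrt (u ⬝ᵥ u) := by
  rw [← Real.sqrt_mul (Nat.cast_nonneg n), frobNorm]
  simp [Matrix.vecMulVec_apply, dotProduct, Finset.mul_sum, sq]

theorem prodFrom_mulVec {n : ℕ} {H : ℕ → Matrix (Fin n) (Fin n) ℝ} {v : ℕ → Fin n → ℝ}
    (hv : ∀ j, v (j + 1) = (H j).mulVec (v j)) (k t : ℕ) :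
    (prodFrom H k t).mulVec (v k) = v (k + t) := by
  induction t with
  | zero => simp [prodFrom]
  | succ t ih => rw [prodFrom, ← Matrix.mulVec_mulVec, ih, ← add_assoc, hv]

theorem sum_mulVec_of_sum_col_eq_one {m n : ℕ} {A : Matrix (Fin m) (Fin n) ℝ}
    (hA : ∀ l, ∑ i, A i l = 1) (u : Fin n → ℝ) : ∑ i, A.mulVec u i = ∑ i, u i := by
  simp only [Matrix.mulVec, dotProduct]
  rw [Finset.sum_comm]
  simp [← Finset.sum_mul, hA]

/-- **Rank-one approximation of the normalized push product ((A.9)/(A.10)).** If the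
column-stochastic product `Φ = H^{k+t-1} ⋯ H^k` is `ε`-close in Frobenius norm to a
rank-one matrix `φ 1ᵀ` with `φ` stochastic, and every nonzero entry of `v^{k+t}` is at
least `κ > 0`, then the normalized product `(V^{k+t})† Φ V^k` is close to
`(1/s) 1_V (v^k)ᵀ`:
`‖(V^{k+t})† Φ V^k - (1/s) 1_V (v^k)ᵀ‖_F ≤ (ε/κ)(1 + √n ‖v^k‖₂ / s) max_i v^k_i`. -/
theorem push_rank_one_approximation {n : ℕ}
    (H : ℕ → Matrix (Fin n) (Fin n) ℝ)
    (hHnn : ∀ j i l, 0 ≤ H j i l)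
    (hHcol : ∀ j l, ∑ i, H j i l = 1)
    (v : ℕ → Fin n → ℝ) (hv0nn : ∀ i, 0 ≤ v 0 i)
    (s : ℝ) (hs : ∑ i, v 0 i = s) (hspos : 0 < s)
    (hv : ∀ j, v (j + 1) = (H j).mulVec (v j))
    (k t : ℕ) (ht : 1 ≤ t)
    (φ : Fin n → ℝ) (hφnn : ∀ i, 0 ≤ φ i) (hφsum : ∑ i, φ i = 1)
    (ε : ℝ)
    (hε : frobNorm (prodFrom H k t - Matrix.vecMulVec φ (fun _ => 1)) ≤ ε)
    (κ : ℝ) (hκ : 0 < κ)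
    (hsupp : ∀ i, v (k + t) i ≠ 0 → κ ≤ v (k + t) i) :
    frobNorm
      (Matrix.diagonal (fun i => if v (k + t) i = 0 then 0 else (v (k + t) i)⁻¹) *
          prodFrom H k t * Matrix.diagonal (v k) -
        (1 / s) • Matrix.vecMulVec (fun i => if v (k + t) i = 0 then 0 else 1) (v k)) ≤
      (ε / κ) * (1 + Real.sqrt n * Real.sqrt (v k ⬝ᵥ v k) / s) * (⨆ i, v k i) := by
  have hnn : ∀ j i, 0 ≤ v j i := by
    intro j
    induction j with
    | zero => exact hv0nn
    | succ j ih =>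
      intro i
      rw [hv, Matrix.mulVec, dotProduct]
      exact Finset.sum_nonneg fun l _ => mul_nonneg (hHnn j i l) (ih l)
  have hsum : ∀ j, ∑ i, v j i = s := by
    intro j
    induction j with
    | zero => exact hs
    | succ j ih => rw [hv, sum_mulVec_of_sum_col_eq_one (hHcol j), ih]
  set E := prodFrom H k t - Matrix.vecMulVec φ (fun _ => 1) with hE
  set M := ⨆ i, v k i
  have hle : ∀ i, v k i ≤ M := le_ciSup (Set.finite_range (v k)).bddAbove
  have hM0 : 0 ≤ M := Real.iSup_nonneg (hnn k)
  have hEv : ∀ i, E.mulVec (v k) i = v (k + t) i - s * φ i := by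
    intro i
    rw [hE, Matrix.sub_mulVec, prodFrom_mulVec hv, Pi.sub_apply]
    simp [Matrix.mulVec, dotProduct, Matrix.vecMulVec_apply, ← Finset.mul_sum, hsum,
      mul_comm s]
  set F := E - (1 / s) • (E * Matrix.vecMulVec (v k) (fun _ : Fin n => (1 : ℝ))) with hF
  have hFij : ∀ i j, F i j = prodFrom H k t i j - v (k + t) i / s := by
    intro i j
    have h : F i j = E i j - (1 / s) * E.mulVec (v k) i := by
      simp [hF, Matrix.mul_vecMulVec, Matrix.vecMulVec_apply]
    rw [h, hEv, hE]
    simp only [Matrix.sub_apply, Matrix.vecMulVec_apply]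
    field_simp
    ring
  have hFnorm : frobNorm F ≤ ε * (1 + Real.sqrt n * Real.sqrt (v k ⬝ᵥ v k) / s) := by
    calc frobNorm F
        ≤ frobNorm E + |1 / s| * (frobNorm E * (Real.sqrt n * Real.sqrt (v k ⬝ᵥ v k))) := by
          refine (frobNorm_sub_le _ _).trans ?_
          rw [frobNorm_smul, ← frobNorm_vecMulVec_one]
          gcongr
          exact frobNorm_mul_le _ _
      _ = frobNorm E * (1 + Real.sqrt n * Real.sqrt (v k ⬝ᵥ v k) / s) := by
          rw [abs_of_pos (by positivity)]
          ring
      _ ≤ _ := by gcongr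
  have hentry : ∀ i j,
      |(Matrix.diagonal (fun i => if v (k + t) i = 0 then 0 else (v (k + t) i)⁻¹) *
          prodFrom H k t * Matrix.diagonal (v k) -
        (1 / s) • Matrix.vecMulVec (fun i => if v (k + t) i = 0 then 0 else 1) (v k)) i j| ≤
      |((M / κ) • F) i j| := by
    intro i j
    simp only [Matrix.sub_apply, Matrix.smul_apply, Matrix.mul_diagonal, Matrix.diagonal_mul,
      Matrix.vecMulVec_apply, smul_eq_mul]
    by_cases h0 : v (k + t) i = 0
    · simp only [h0, if_true, zero_mul, mul_zero, sub_zero, abs_zero]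
      positivity
    · have hκi := hsupp i h0
      have hpos : 0 < v (k + t) i := hκ.trans_le hκi
      have h : (v (k + t) i)⁻¹ * prodFrom H k t i j * v k j - 1 / s * (1 * v k j) =
          v k j / v (k + t) i * F i j := by
        rw [hFij]
        field_simp
      rw [if_neg h0, if_neg h0, h, abs_mul, abs_mul,
        abs_of_nonneg (div_nonneg (hnn k j) hpos.le), abs_of_nonneg (div_nonneg hM0 hκ.le)]
      gcongr
      exact hle j
  calc _ ≤ frobNorm ((M / κ) • F) := frobNorm_mono hentry
    _ = M / κ * frobNorm F := by rw [frobNorm_smul, abs_of_nonneg (div_nonneg hM0 hκ.le)]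
    _ ≤ M / κ * (ε * (1 + Real.sqrt n * Real.sqrt (v k ⬝ᵥ v k) / s)) := by gcongr
    _ = _ := by ring
end

section
/- Let {Q^k}_{k≥0} be n×n column-stochastic real matrices, and let B ≥ 1 be an integer and κ ∈ (0,1) be such that for every k ≥ 0 there exists a row index i (depending on k) for which every entry of the i-th row of the product Q^{k+B−1} ⋯ Q^k is at least κ. Then for every k ≥ 0 and t ≥ 0 there exists a stochastic vector φ^{k,t} ∈ ℝ^n such that ‖Q^{k+t−1} ⋯ Q^k − φ^{k,t} 1^T‖_F ≤ (2√n / (1−κ)) · (1−κ)^{t/B} (with the empty product for t = 0 interpreted as the identity). -/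
open Matrix

lemma prodFrom_add {n : ℕ} (M : ℕ → Matrix (Fin n) (Fin n) ℝ) (k s t : ℕ) :
    prodFrom M k (s + t) = prodFrom M (k + s) t * prodFrom M k s := by
  induction t with
  | zero => simp [prodFrom]
  | succ t ih => rw [← add_assoc, prodFrom, prodFrom, ih, Matrix.mul_assoc, add_assoc]

lemma prodFrom_mem_colStochastic {n : ℕ} {M : ℕ → Matrix (Fin n) (Fin n) ℝ}
    (hM : ∀ k, M k ∈ colStochastic ℝ (Fin n)) (k t : ℕ) :
    prodFrom M k t ∈ colStochastic ℝ (Fin n) := by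
  induction t with
  | zero => exact one_mem _
  | succ t ih => exact mul_mem (hM _) ih

/-- A column-stochastic matrix with a row bounded below by `κ` contracts the `ℓ¹` norm of
vectors with zero sum by the factor `1 - κ`. -/
lemma sum_abs_mulVec_le_of_row_ge {ι : Type*} [Fintype ι] [DecidableEq ι]
    {A : Matrix ι ι ℝ} (hA : A ∈ colStochastic ℝ ι) {κ : ℝ} {i₀ : ι}
    (hrow : ∀ j, κ ≤ A i₀ j) {x : ι → ℝ} (hx : ∑ j, x j = 0) :
    ∑ i, |(A *ᵥ x) i| ≤ (1 - κ) * ∑ j, |x j| := by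
  have hnn : ∀ i j, 0 ≤ A i j - (if i = i₀ then κ else 0) := by
    intro i j
    split_ifs with h
    · subst h
      linarith [hrow j]
    · simpa using nonneg_of_mem_colStochastic hA
  have hshift : ∀ i, (A *ᵥ x) i = ∑ j, (A i j - (if i = i₀ then κ else 0)) * x j := by
    intro i
    simp [sub_mul, Finset.sum_sub_distrib, ← Finset.mul_sum, hx, mulVec, dotProduct]
  calc ∑ i, |(A *ᵥ x) i|
      ≤ ∑ i, ∑ j, (A i j - (if i = i₀ then κ else 0)) * |x j| := by
        refine Finset.sum_le_sum fun i _ => ?_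
        rw [hshift]
        refine (Finset.abs_sum_le_sum_abs _ _).trans_eq (Finset.sum_congr rfl fun j _ => ?_)
        rw [abs_mul, abs_of_nonneg (hnn i j)]
    _ = (1 - κ) * ∑ j, |x j| := by
        rw [Finset.sum_comm, Finset.mul_sum]
        refine Finset.sum_congr rfl fun j _ => ?_
        rw [← Finset.sum_mul, Finset.sum_sub_distrib, sum_col_of_mem_colStochastic hA]
        simp

lemma sum_abs_mulVec_le_of_mem_colStochastic {ι : Type*} [Fintype ι] [DecidableEq ι]
    {A : Matrix ι ι ℝ} (hA : A ∈ colStochastic ℝ ι) {x : ι → ℝ} (hx : ∑ j, x j = 0) :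
    ∑ i, |(A *ᵥ x) i| ≤ ∑ j, |x j| := by
  cases isEmpty_or_nonempty ι with
  | inl _ => simp
  | inr h =>
    simpa using sum_abs_mulVec_le_of_row_ge hA (κ := 0) (i₀ := h.some)
      (fun _ => nonneg_of_mem_colStochastic hA) hx

lemma sum_abs_prodFrom_mul_mulVec_le {n : ℕ} {Q : ℕ → Matrix (Fin n) (Fin n) ℝ}
    (hQ : ∀ k, Q k ∈ colStochastic ℝ (Fin n)) {B : ℕ} {κ : ℝ} (hκ1 : κ ≤ 1)
    (hrow : ∀ k, ∃ i, ∀ j, κ ≤ prodFrom Q k B i j) {x : Fin n → ℝ} (hx : ∑ j, x j = 0)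
    (k q : ℕ) :
    ∑ i, |(prodFrom Q k (B * q) *ᵥ x) i| ≤ (1 - κ) ^ q * ∑ j, |x j| := by
  induction q with
  | zero => simp [prodFrom]
  | succ q ih =>
    obtain ⟨i, hi⟩ := hrow (k + B * q)
    rw [Nat.mul_succ, prodFrom_add, ← mulVec_mulVec, pow_succ', mul_assoc]
    refine (sum_abs_mulVec_le_of_row_ge (prodFrom_mem_colStochastic hQ _ _) hi ?_).trans
      (mul_le_mul_of_nonneg_left ih (sub_nonneg.2 hκ1))
    rw [sum_mulVec_of_mem_colStochastic (prodFrom_mem_colStochastic hQ _ _), hx]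

lemma sum_abs_prodFrom_mulVec_le {n : ℕ} {Q : ℕ → Matrix (Fin n) (Fin n) ℝ}
    (hQ : ∀ k, Q k ∈ colStochastic ℝ (Fin n)) {B : ℕ} {κ : ℝ} (hκ1 : κ ≤ 1)
    (hrow : ∀ k, ∃ i, ∀ j, κ ≤ prodFrom Q k B i j) {x : Fin n → ℝ} (hx : ∑ j, x j = 0)
    (k t : ℕ) :
    ∑ i, |(prodFrom Q k t *ᵥ x) i| ≤ (1 - κ) ^ (t / B) * ∑ j, |x j| := by
  conv_lhs => rw [← Nat.div_add_mod t B]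
  rw [prodFrom_add, ← mulVec_mulVec]
  refine (sum_abs_mulVec_le_of_mem_colStochastic (prodFrom_mem_colStochastic hQ _ _) ?_).trans
    (sum_abs_prodFrom_mul_mulVec_le hQ hκ1 hrow hx k _)
  rw [sum_mulVec_of_mem_colStochastic (prodFrom_mem_colStochastic hQ _ _), hx]

/-- A matrix whose columns all have `ℓ¹` norm at most `c` has Frobenius norm at most `√n c`. -/
lemma frobNorm_le_of_sum_abs_col_le {m n : ℕ} {A : Matrix (Fin m) (Fin n) ℝ} {c : ℝ}
    (hc : 0 ≤ c) (h : ∀ j, ∑ i, |A i j| ≤ c) : frobNorm A ≤ Real.sqrt n * c := by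
  rw [frobNorm, ← Real.sqrt_sq hc, ← Real.sqrt_mul n.cast_nonneg, Finset.sum_comm]
  refine Real.sqrt_le_sqrt ?_
  have hcol : ∀ j ∈ Finset.univ, ∑ i, A i j ^ 2 ≤ c ^ 2 := fun j _ =>
    calc ∑ i, A i j ^ 2 = ∑ i, |A i j| ^ 2 := by simp
      _ ≤ (∑ i, |A i j|) ^ 2 := Finset.sum_sq_le_sq_sum_of_nonneg fun _ _ => abs_nonneg _
      _ ≤ c ^ 2 := pow_le_pow_left₀ (Finset.sum_nonneg fun _ _ => abs_nonneg _) (h j) 2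
  simpa using Finset.sum_le_card_nsmul _ _ _ hcol

lemma pow_div_le_rpow_div {a : ℝ} (ha0 : 0 < a) (ha1 : a ≤ 1) (t B : ℕ) :
    a ^ (t / B) ≤ a ^ ((t : ℝ) / B) / a := by
  rw [← Real.rpow_sub_one ha0.ne', ← Real.rpow_natCast]
  refine Real.rpow_le_rpow_of_exponent_ge ha0 ha1 ?_
  rw [← Nat.floor_div_eq_div (K := ℝ)]
  exact (Nat.sub_one_lt_floor _).le

/-- **Geometric ergodicity of column-stochastic products (Lemma A.1, column half).**
If each `B`-fold product `Q^{k+B-1} ⋯ Q^k` of the column-stochastic matrices has a row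
that is entrywise at least `κ`, then for all `k, t` there is a stochastic vector `φ`
with `‖Q^{k+t-1} ⋯ Q^k - φ 1ᵀ‖_F ≤ (2√n/(1-κ)) (1-κ)^{t/B}`. -/
theorem column_stochastic_products_ergodic {n : ℕ}
    (Q : ℕ → Matrix (Fin n) (Fin n) ℝ)
    (hQnn : ∀ k i j, 0 ≤ Q k i j)
    (hQcol : ∀ k j, ∑ i, Q k i j = 1)
    (B : ℕ) (hB : 1 ≤ B) (κ : ℝ) (hκ0 : 0 < κ) (hκ1 : κ < 1)
    (hrow : ∀ k, ∃ i, ∀ j, κ ≤ prodFrom Q k B i j) :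
    ∀ k t, ∃ φ : Fin n → ℝ, (∀ i, 0 ≤ φ i) ∧ (∑ i, φ i = 1) ∧
      frobNorm (prodFrom Q k t - Matrix.vecMulVec φ (fun _ => 1)) ≤
        (2 * Real.sqrt n / (1 - κ)) * (1 - κ) ^ ((t : ℝ) / (B : ℝ)) := by
  have hQ : ∀ k, Q k ∈ colStochastic ℝ (Fin n) := fun k =>
    mem_colStochastic_iff_sum.2 ⟨hQnn k, hQcol k⟩
  intro k t
  obtain ⟨j₀, -⟩ := hrow 0
  have hP := prodFrom_mem_colStochastic hQ k t
  refine ⟨fun i => prodFrom Q k t i j₀, fun i => nonneg_of_mem_colStochastic hP,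
    sum_col_of_mem_colStochastic hP j₀, ?_⟩
  have hpos : 0 < 1 - κ := sub_pos.2 hκ1
  have hcol : ∀ j, ∑ i, |(prodFrom Q k t - vecMulVec (fun i => prodFrom Q k t i j₀) (fun _ => 1) :
      Matrix (Fin n) (Fin n) ℝ) i j| ≤ (1 - κ) ^ (t / B) * 2 := by
    intro j
    have hx : ∑ i, (Pi.single j 1 - Pi.single j₀ 1 : Fin n → ℝ) i = 0 := by
      simp [Finset.sum_sub_distrib]
    have hx2 : ∑ i, |(Pi.single j 1 - Pi.single j₀ 1 : Fin n → ℝ) i| ≤ 2 :=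
      calc ∑ i, |(Pi.single j 1 - Pi.single j₀ 1 : Fin n → ℝ) i|
          ≤ ∑ i, (|(Pi.single j 1 : Fin n → ℝ) i| + |(Pi.single j₀ 1 : Fin n → ℝ) i|) :=
            Finset.sum_le_sum fun i _ => abs_sub _ _
        _ = 2 := by
            simp only [Finset.sum_add_distrib, Pi.single_apply, apply_ite abs, abs_one, abs_zero,
              Finset.sum_ite_eq', Finset.mem_univ, if_true]
            norm_num
    have h := (sum_abs_prodFrom_mulVec_le hQ hκ1.le hrow hx k t).trans
      (mul_le_mul_of_nonneg_left hx2 (pow_nonneg hpos.le _))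
    simpa [mulVec_sub, vecMulVec_apply] using h
  calc frobNorm (prodFrom Q k t - vecMulVec (fun i => prodFrom Q k t i j₀) (fun _ => 1))
      ≤ Real.sqrt n * ((1 - κ) ^ (t / B) * 2) :=
        frobNorm_le_of_sum_abs_col_le (by positivity) hcol
    _ ≤ Real.sqrt n * ((1 - κ) ^ ((t : ℝ) / B) / (1 - κ) * 2) := by
        gcongr
        exact pow_div_le_rpow_div hpos (by linarith) t B
    _ = 2 * Real.sqrt n / (1 - κ) * (1 - κ) ^ ((t : ℝ) / B) := by ring
end
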